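/- Let 0 < μ ≤ 1/2 and suppose L ≥ 4πd/μ. Then for every subset Ω ⊆ Λ, the eigenvalue-sum difference satisfies δE(μ,Ω) := Tr{[-Δ̃ - μ·Id]_-} - Tr{[-Δ - μ·Id]_-} ≥ α(μ)·|∂Ω|, where Δ̃ := P_Ω Δ P_Ω + P_Ω^⊥ Δ P_Ω^⊥ and α(μ) := |S^{d-1}| μ^{(2+d)/2} / (2^{1+d/2}(2π)^d(4d)^5) with |S^{d-1}| = 2π^{d/2}/Γ(d/2) the surface measure of the unit sphere in ℝ^d. -/

import Mathlib

open Matrix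
open scoped BigOperators Classical ComplexOrder

noncomputable section

/-- The discrete torus `Λ = (ℤ/Lℤ)^d`. -/
abbrev Lam (d L : ℕ) : Type := Fin d → ZMod L

/-- `x` and `y` are nearest neighbors on the torus (ℓ¹-distance 1). -/
def isNN {d L : ℕ} (x y : Lam d L) : Prop :=
  ∃ ν : Fin d, (x ν = y ν + 1 ∨ x ν + 1 = y ν) ∧ ∀ μ : Fin d, μ ≠ ν → x μ = y μ

/-- The discrete Laplacian `Δ = T - 2d·Id` on the torus. -/
def lap (d L : ℕ) : Matrix (Lam d L) (Lam d L) ℂ :=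
  (Matrix.of fun x y => if isNN x y then (1 : ℂ) else 0) - (2 * (d : ℂ)) • 1

/-- A one-particle density matrix: hermitian with `0 ≤ γ ≤ 1` as quadratic forms. -/
def IsDM {d L : ℕ} [NeZero L] (γ : Matrix (Lam d L) (Lam d L) ℂ) : Prop :=
  γ.PosSemidef ∧ (1 - γ).PosSemidef

/-- `Tr{[X]_-}`: the sum of the negative eigenvalues of a hermitian matrix `X`
(junk value `0` if `X` is not hermitian). -/
def negTrace {n : Type} [Fintype n] [DecidableEq n] (X : Matrix n n ℂ) : ℝ :=
  if hX : X.IsHermitian then ∑ i, min (hX.eigenvalues i) 0 else 0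

/-- The HFz energy functional. -/
def hfzE {d L : ℕ} [NeZero L] (μ U : ℝ) (γu γd : Matrix (Lam d L) (Lam d L) ℂ) : ℝ :=
  (((-(lap d L) - (μ : ℂ) • 1) * (γu + γd)).trace).re
    + U * ∑ x, (γu x x).re * (γd x x).re

/-- The set of HFz energy values over pairs of one-particle density matrices. -/
def hfzEnergies (d L : ℕ) [NeZero L] (μ U : ℝ) : Set ℝ :=
  { E | ∃ γu γd : Matrix (Lam d L) (Lam d L) ℂ, IsDM γu ∧ IsDM γd ∧ hfzE μ U γu γd = E }

/-- The diagonal orthogonal projection `P_A` onto the coordinates in `A`. -/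
def proj {d L : ℕ} (A : Set (Lam d L)) : Matrix (Lam d L) (Lam d L) ℂ :=
  Matrix.diagonal fun x => if x ∈ A then 1 else 0

/-- The boundary `∂Ω := {x ∈ Ω : x has a nearest neighbor outside Ω}`. -/
def bdry {d L : ℕ} (Ω : Set (Lam d L)) : Set (Lam d L) :=
  {x | x ∈ Ω ∧ ∃ y, y ∉ Ω ∧ isNN x y}

/-- `|S^{d-1}| = 2 π^{d/2} / Γ(d/2)`. -/
def sphereMeasure (d : ℕ) : ℝ := 2 * Real.pi ^ ((d : ℝ) / 2) / Real.Gamma ((d : ℝ) / 2)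

/-- `α(μ) := |S^{d-1}| μ^{(2+d)/2} / (2^{1+d/2} (2π)^d (4d)^5)`. -/
def alphaStar (d : ℕ) (μ : ℝ) : ℝ :=
  sphereMeasure d * μ ^ ((2 + (d : ℝ)) / 2) /
    (2 ^ (1 + (d : ℝ) / 2) * (2 * Real.pi) ^ d * (4 * (d : ℝ)) ^ 5)

section SpectralComparison

variable {ι κ E : Type*} [Fintype ι] [Fintype κ] [NormedAddCommGroup E] [InnerProductSpace ℂ E]

lemma inner_apply_of_eigenbasis (w : OrthonormalBasis ι ℂ E) (A : E →ₗ[ℂ] E) (l : ι → ℝ)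
    (hA : ∀ j, A (w j) = (l j : ℂ) • w j) (v : E) (j : ι) :
    inner ℂ (w j) (A v) = (l j : ℂ) * inner ℂ (w j) v := by
  conv_lhs => rw [← w.sum_repr' v]
  simp only [map_sum, map_smul, hA, inner_sum, inner_smul_right,
    orthonormal_iff_ite.mp w.orthonormal]
  simp [mul_comm]

lemma re_inner_apply_of_eigenbasis (w : OrthonormalBasis ι ℂ E) (A : E →ₗ[ℂ] E) (l : ι → ℝ)
    (hA : ∀ j, A (w j) = (l j : ℂ) • w j) (v : E) :
    (inner ℂ v (A v)).re = ∑ j, l j * ‖inner ℂ (w j) v‖ ^ 2 := by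
  rw [← w.sum_inner_mul_inner, Complex.re_sum]
  refine Finset.sum_congr rfl fun j _ => ?_
  rw [inner_apply_of_eigenbasis w A l hA, ← inner_conj_symm v (w j), mul_left_comm,
    mul_comm ((starRingEnd ℂ) _), Complex.mul_conj, Complex.normSq_eq_norm_sq]
  norm_cast

/-- If `b = (A - a) f` has energy at least `‖b‖² / 2`, then `f` has a definite mass in the
nonnegative spectral subspace of `A`. -/
lemma half_norm_sq_le_mass_nonneg (w : OrthonormalBasis ι ℂ E) (A : E →ₗ[ℂ] E) (l : ι → ℝ)
    (hA : ∀ j, A (w j) = (l j : ℂ) • w j) (a C : ℝ) (ha : a ≤ 0)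
    (hl : ∀ j, l j - a ≤ C) (f b : E) (hb : b = A f - (a : ℂ) • f)
    (hen : ‖b‖ ^ 2 / 2 ≤ (inner ℂ b (A b)).re) :
    ‖b‖ ^ 2 / 2 ≤ C ^ 3 * ∑ j with 0 ≤ l j, ‖inner ℂ (w j) f‖ ^ 2 := by
  refine hen.trans ?_
  rw [re_inner_apply_of_eigenbasis w A l hA, Finset.mul_sum, Finset.sum_filter]
  refine Finset.sum_le_sum fun j _ => ?_
  split_ifs with hj
  · have h1 : inner ℂ (w j) b = ((l j - a : ℝ) : ℂ) * inner ℂ (w j) f := by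
      rw [hb, inner_sub_right, inner_apply_of_eigenbasis w A l hA, inner_smul_right]
      push_cast
      ring
    have h0 : 0 ≤ l j - a := by linarith
    have hlj := hl j
    rw [h1, norm_mul, Complex.norm_real, Real.norm_of_nonneg h0, mul_pow, ← mul_assoc]
    gcongr
    calc l j * (l j - a) ^ 2 ≤ C * C ^ 2 := by
          gcongr <;> linarith
      _ = C ^ 3 := by ring
  · exact mul_nonpos_of_nonpos_of_nonneg (by linarith) (by positivity)

/-- Comparison of the sums of negative eigenvalues of `X` and of its pinching `Y`. -/
lemma sum_min_pinching_sub_ge (w : OrthonormalBasis ι ℂ E) (e : OrthonormalBasis κ ℂ E)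
    (X Y : E →ₗ[ℂ] E) (U : E → E) (l : ι → ℝ) (a : κ → ℝ)
    (hY : ∀ j, Y (w j) = (l j : ℂ) • w j) (hX : ∀ k, X (e k) = (a k : ℂ) • e k)
    (hUnorm : ∀ v, ‖U v‖ = ‖v‖) (hUsymm : ∀ v v', inner ℂ (U v) v' = inner ℂ v (U v'))
    (hpin : ∀ v, (inner ℂ v (Y v)).re =
      ((inner ℂ v (X v)).re + (inner ℂ (U v) (X (U v))).re) / 2) :
    ∑ k, -min (a k) 0 * ((∑ j with 0 ≤ l j, ‖inner ℂ (w j) (e k)‖ ^ 2 +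
        ∑ j with 0 ≤ l j, ‖inner ℂ (w j) (U (e k))‖ ^ 2) / 2) ≤
      ∑ j, min (l j) 0 - ∑ k, min (a k) 0 := by
  have hl : ∀ j, l j = ∑ k, a k *
      ((‖inner ℂ (w j) (e k)‖ ^ 2 + ‖inner ℂ (w j) (U (e k))‖ ^ 2) / 2) := by
    intro j
    have h1 := hpin (w j)
    rw [re_inner_apply_of_eigenbasis e X a hX, re_inner_apply_of_eigenbasis e X a hX, hY,
      inner_smul_right, inner_self_eq_norm_sq_to_K, w.norm_eq_one] at h1
    simp only [Complex.coe_algebraMap, Complex.ofReal_one, one_pow, mul_one,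
      Complex.ofReal_re] at h1
    rw [h1, ← Finset.sum_add_distrib, Finset.sum_div]
    refine Finset.sum_congr rfl fun k _ => ?_
    rw [← hUsymm (e k), norm_inner_symm (e k), norm_inner_symm (U (e k))]
    ring
  have hsum : ∀ v : E, ∑ j with 0 ≤ l j, ‖inner ℂ (w j) v‖ ^ 2 =
      ‖v‖ ^ 2 - ∑ j with ¬ 0 ≤ l j, ‖inner ℂ (w j) v‖ ^ 2 := by
    intro v
    rw [← w.sum_sq_norm_inner_right v,
      ← Finset.sum_filter_add_sum_filter_not Finset.univ (fun j => 0 ≤ l j)]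
    ring
  have hneg : ∑ j, min (l j) 0 = ∑ k, a k *
      ((∑ j with ¬ 0 ≤ l j, ‖inner ℂ (w j) (e k)‖ ^ 2 +
        ∑ j with ¬ 0 ≤ l j, ‖inner ℂ (w j) (U (e k))‖ ^ 2) / 2) := by
    calc ∑ j, min (l j) 0 = ∑ j with ¬ 0 ≤ l j, l j := by
          rw [Finset.sum_filter]
          refine Finset.sum_congr rfl fun j _ => ?_
          split_ifs with h
          · exact min_eq_right h
          · exact min_eq_left (not_le.mp h).le
      _ = ∑ j with ¬ 0 ≤ l j, ∑ k, a k *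
            ((‖inner ℂ (w j) (e k)‖ ^ 2 + ‖inner ℂ (w j) (U (e k))‖ ^ 2) / 2) :=
          Finset.sum_congr rfl fun j _ => hl j
      _ = _ := by
          rw [Finset.sum_comm]
          refine Finset.sum_congr rfl fun k _ => ?_
          rw [← Finset.mul_sum, ← Finset.sum_div, Finset.sum_add_distrib]
  rw [hneg, ← Finset.sum_sub_distrib]
  refine Finset.sum_le_sum fun k _ => ?_
  rw [hsum, hsum, hUnorm, e.norm_eq_one]
  set p := ∑ j with ¬ 0 ≤ l j, ‖inner ℂ (w j) (e k)‖ ^ 2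
  set q := ∑ j with ¬ 0 ≤ l j, ‖inner ℂ (w j) (U (e k))‖ ^ 2
  have hp : 0 ≤ p := by positivity
  have hq : 0 ≤ q := by positivity
  nlinarith [min_le_left (a k) 0, mul_nonneg (sub_nonneg.mpr (min_le_left (a k) 0)) hp,
    mul_nonneg (sub_nonneg.mpr (min_le_left (a k) 0)) hq]

/-- Variational upper bound for the sum of negative eigenvalues. -/
lemma sum_min_le_sum_min (w : OrthonormalBasis ι ℂ E) (e : OrthonormalBasis κ ℂ E)
    (X : E →ₗ[ℂ] E) (l : ι → ℝ) (a : κ → ℝ)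
    (hw : ∀ j, X (w j) = (l j : ℂ) • w j) (he : ∀ k, X (e k) = (a k : ℂ) • e k) :
    ∑ j, min (l j) 0 ≤ ∑ k, min (a k) 0 := by
  have h := sum_min_pinching_sub_ge e w X X id a l he hw (fun _ => rfl) (fun _ _ => rfl)
    (fun v => by simp)
  have h0 : 0 ≤ ∑ k, -min (l k) 0 * ((∑ j with 0 ≤ a j, ‖inner ℂ (e j) (w k)‖ ^ 2 +
        ∑ j with 0 ≤ a j, ‖inner ℂ (e j) (id (w k))‖ ^ 2) / 2) :=
    Finset.sum_nonneg fun k _ =>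
      mul_nonneg (neg_nonneg.mpr (min_le_right _ _)) (by positivity)
  linarith

end SpectralComparison

section Hopping

variable {n : Type} [Fintype n] [DecidableEq n]

/-- The hopping matrix `m - T_c`, where `T_c` is the `0`-`1` matrix of the relation `c`. -/
def hopMatrix (c : n → n → Prop) (m : ℝ) : Matrix n n ℂ :=
  (m : ℂ) • 1 - Matrix.of fun x y => if c x y then 1 else 0

omit [Fintype n] in
lemma hopMatrix_isHermitian {c : n → n → Prop} (hc : ∀ x y, c x y → c y x) (m : ℝ) :
    (hopMatrix c m).IsHermitian := by
  ext x y
  have h : c x y ↔ c y x := ⟨hc x y, hc y x⟩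
  by_cases hxy : x = y
  · subst hxy
    by_cases hx : c x x <;> simp [hopMatrix, hx]
  · simp [hopMatrix, one_apply, hxy, Ne.symm hxy, h, apply_ite]

lemma toEuclideanLin_hopMatrix_apply (c : n → n → Prop) (m : ℝ) (v : EuclideanSpace ℂ n)
    (x : n) :
    toEuclideanLin (hopMatrix c m) v x = m * v x - ∑ y, if c x y then v y else 0 := by
  simp [hopMatrix, Matrix.toLpLin_apply, smul_mulVec, mulVec, dotProduct]

lemma re_inner_hopMatrix (c : n → n → Prop) (m : ℝ) (v : EuclideanSpace ℂ n) :
    (inner ℂ v (toEuclideanLin (hopMatrix c m) v)).re =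
      m * ‖v‖ ^ 2 - ∑ x, ∑ y, if c x y then ((starRingEnd ℂ) (v x) * v y).re else 0 := by
  rw [PiLp.inner_apply, Complex.re_sum, EuclideanSpace.norm_sq_eq, Finset.mul_sum,
    ← Finset.sum_sub_distrib]
  refine Finset.sum_congr rfl fun x _ => ?_
  rw [toEuclideanLin_hopMatrix_apply, RCLike.inner_apply, sub_mul, Complex.sub_re, mul_assoc,
    Complex.mul_conj, Complex.normSq_eq_norm_sq, Finset.sum_mul, Complex.re_sum]
  congr 1
  · norm_cast
  · refine Finset.sum_congr rfl fun y _ => ?_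
    split_ifs
    · rw [mul_comm]
    · simp

omit [DecidableEq n] in
lemma abs_sum_hopping_le {c : n → n → Prop} (hc : ∀ x y, c x y → c y x)
    (v : EuclideanSpace ℂ n) (D : ℝ)
    (hD : ∀ x, v x ≠ 0 → (∑ y, if c x y then (1 : ℝ) else 0) ≤ D) :
    |∑ x, ∑ y, if c x y then ((starRingEnd ℂ) (v x) * v y).re else 0| ≤ D * ‖v‖ ^ 2 := by
  have hsymm : ∑ x, ∑ y, (if c x y then ‖v y‖ ^ 2 else 0) =
      ∑ x, ∑ y, if c x y then ‖v x‖ ^ 2 else 0 := by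
    rw [Finset.sum_comm]
    refine Finset.sum_congr rfl fun x _ => Finset.sum_congr rfl fun y _ => ?_
    rw [if_congr (⟨hc y x, hc x y⟩ : c y x ↔ c x y) rfl rfl]
  calc |∑ x, ∑ y, if c x y then ((starRingEnd ℂ) (v x) * v y).re else 0|
      ≤ ∑ x, ∑ y, if c x y then (‖v x‖ ^ 2 + ‖v y‖ ^ 2) / 2 else 0 := by
        refine (Finset.abs_sum_le_sum_abs _ _).trans (Finset.sum_le_sum fun x _ => ?_)
        refine (Finset.abs_sum_le_sum_abs _ _).trans (Finset.sum_le_sum fun y _ => ?_)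
        split_ifs
        · refine (Complex.abs_re_le_norm _).trans ?_
          rw [norm_mul, Complex.norm_conj]
          nlinarith [sq_nonneg (‖v x‖ - ‖v y‖)]
        · simp
    _ = (∑ x, ∑ y, (if c x y then ‖v x‖ ^ 2 else 0) +
          ∑ x, ∑ y, if c x y then ‖v y‖ ^ 2 else 0) / 2 := by
        simp only [← Finset.sum_add_distrib, Finset.sum_div]
        refine Finset.sum_congr rfl fun x _ => Finset.sum_congr rfl fun y _ => ?_
        split_ifs <;> simp
    _ = ∑ x, ∑ y, if c x y then ‖v x‖ ^ 2 else 0 := by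
        rw [hsymm]
        ring
    _ ≤ D * ‖v‖ ^ 2 := by
        rw [EuclideanSpace.norm_sq_eq, Finset.mul_sum]
        refine Finset.sum_le_sum fun x _ => ?_
        by_cases hx : v x = 0
        · simp [hx]
        · calc (∑ y, if c x y then ‖v x‖ ^ 2 else 0)
              = (∑ y, if c x y then (1 : ℝ) else 0) * ‖v x‖ ^ 2 := by
                rw [Finset.sum_mul]
                exact Finset.sum_congr rfl fun y _ => by split_ifs <;> simp
            _ ≤ D * ‖v x‖ ^ 2 := by
                gcongr
                exact hD x hx

/-- The relation `c` restricted to pairs on the same side of `A`. -/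
def sameSideRel (c : n → n → Prop) (A : Set n) (x y : n) : Prop := c x y ∧ (x ∈ A ↔ y ∈ A)

/-- The relation `c` restricted to pairs on different sides of `A`. -/
def crossRel (c : n → n → Prop) (A : Set n) (x y : n) : Prop := c x y ∧ ¬ (x ∈ A ↔ y ∈ A)

/-- The sign flip outside `A`. -/
def signFlip (A : Set n) (v : EuclideanSpace ℂ n) : EuclideanSpace ℂ n :=
  WithLp.toLp 2 fun x => if x ∈ A then v x else -v x

omit [Fintype n] [DecidableEq n] in
lemma signFlip_apply (A : Set n) (v : EuclideanSpace ℂ n) (x : n) :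
    signFlip A v x = if x ∈ A then v x else -v x := rfl

omit [DecidableEq n] in
lemma norm_signFlip (A : Set n) (v : EuclideanSpace ℂ n) : ‖signFlip A v‖ = ‖v‖ := by
  rw [EuclideanSpace.norm_eq, EuclideanSpace.norm_eq]
  congr 1
  refine Finset.sum_congr rfl fun x _ => ?_
  rw [signFlip_apply]
  split_ifs <;> simp

omit [DecidableEq n] in
lemma inner_signFlip (A : Set n) (v v' : EuclideanSpace ℂ n) :
    inner ℂ (signFlip A v) v' = inner ℂ v (signFlip A v') := by
  rw [PiLp.inner_apply, PiLp.inner_apply]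
  refine Finset.sum_congr rfl fun x _ => ?_
  rw [signFlip_apply, signFlip_apply]
  split_ifs <;> simp

lemma re_inner_hopMatrix_pinching (c : n → n → Prop) (A : Set n) (m : ℝ)
    (v : EuclideanSpace ℂ n) :
    (inner ℂ v (toEuclideanLin (hopMatrix (sameSideRel c A) m) v)).re =
      ((inner ℂ v (toEuclideanLin (hopMatrix c m) v)).re +
        (inner ℂ (signFlip A v) (toEuclideanLin (hopMatrix c m) (signFlip A v))).re) / 2 := by
  have h : ∑ x, ∑ y, (if sameSideRel c A x y then
        ((starRingEnd ℂ) (v x) * v y).re else 0) =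
      (∑ x, ∑ y, (if c x y then ((starRingEnd ℂ) (v x) * v y).re else 0) +
        ∑ x, ∑ y, if c x y then
          ((starRingEnd ℂ) (signFlip A v x) * signFlip A v y).re else 0) / 2 := by
    simp only [← Finset.sum_add_distrib, Finset.sum_div]
    refine Finset.sum_congr rfl fun x _ => Finset.sum_congr rfl fun y _ => ?_
    rw [signFlip_apply, signFlip_apply]
    by_cases h1 : c x y <;> by_cases h2 : x ∈ A <;> by_cases h3 : y ∈ A <;>
      simp [sameSideRel, h1, h2, h3]
  rw [re_inner_hopMatrix, re_inner_hopMatrix, re_inner_hopMatrix, norm_signFlip, h]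
  ring

lemma hopMatrix_pinching_signFlip (c : n → n → Prop) (A : Set n) (m : ℝ)
    (v : EuclideanSpace ℂ n) :
    toEuclideanLin (hopMatrix (sameSideRel c A) m) (signFlip A v) =
      signFlip A (toEuclideanLin (hopMatrix (sameSideRel c A) m) v) := by
  ext x
  have h : ∀ y, (if sameSideRel c A x y then signFlip A v y else 0) =
      (if x ∈ A then (1 : ℂ) else -1) * if sameSideRel c A x y then v y else 0 := by
    intro y
    rw [signFlip_apply]
    by_cases h2 : x ∈ A <;> by_cases h3 : y ∈ A <;> simp [sameSideRel, h2, h3]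
  rw [signFlip_apply, toEuclideanLin_hopMatrix_apply, toEuclideanLin_hopMatrix_apply,
    Finset.sum_congr rfl fun y _ => h y, ← Finset.mul_sum, signFlip_apply]
  split_ifs <;> ring

lemma hopMatrix_pinching_sub (c : n → n → Prop) (A : Set n) (m : ℝ)
    (v : EuclideanSpace ℂ n) (x : n) :
    toEuclideanLin (hopMatrix (sameSideRel c A) m) v x -
      toEuclideanLin (hopMatrix c m) v x =
        ∑ y, if crossRel c A x y then v y else 0 := by
  rw [toEuclideanLin_hopMatrix_apply, toEuclideanLin_hopMatrix_apply, sub_sub_sub_cancel_left,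
    ← Finset.sum_sub_distrib]
  refine Finset.sum_congr rfl fun y _ => ?_
  by_cases h1 : c x y <;> by_cases h2 : (x ∈ A ↔ y ∈ A) <;>
    simp [sameSideRel, crossRel, h1, h2]

lemma toEuclideanLin_eigenvectorBasis {M : Matrix n n ℂ} (hM : M.IsHermitian) (j : n) :
    toEuclideanLin M (hM.eigenvectorBasis j) =
      (hM.eigenvalues j : ℂ) • hM.eigenvectorBasis j := by
  ext x
  have h := congrFun (hM.mulVec_eigenvectorBasis j) x
  simpa [Matrix.toLpLin_apply] using h

end Hopping

section Torus

variable {d L : ℕ}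

lemma isNN_symm {x y : Lam d L} (h : isNN x y) : isNN y x := by
  obtain ⟨ν, h1, h2⟩ := h
  exact ⟨ν, h1.symm.imp Eq.symm Eq.symm, fun μ hμ => (h2 μ hμ).symm⟩

/-- The `2d` unit steps on the torus. -/
def unitStep (p : Fin d × Bool) : Lam d L :=
  Pi.single p.1 (if p.2 then 1 else -1)

lemma isNN_iff_exists_unitStep {x y : Lam d L} : isNN x y ↔ ∃ p, x + unitStep p = y := by
  constructor
  · rintro ⟨ν, h1 | h1, h2⟩
    · refine ⟨(ν, false), funext fun μ => ?_⟩
      by_cases hμ : μ = ν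
      · subst hμ
        simp [unitStep, h1]
      · simp [unitStep, h2 μ hμ, hμ]
    · refine ⟨(ν, true), funext fun μ => ?_⟩
      by_cases hμ : μ = ν
      · subst hμ
        simp [unitStep, h1]
      · simp [unitStep, h2 μ hμ, hμ]
  · rintro ⟨⟨ν, s⟩, rfl⟩
    refine ⟨ν, ?_, fun μ hμ => by simp [unitStep, hμ]⟩
    cases s <;> simp [unitStep]

lemma unitStep_injective (hL : 3 ≤ L) : Function.Injective (unitStep : Fin d × Bool → Lam d L) := by
  have h1 : (1 : ZMod L) ≠ 0 := by
    have := (ZMod.natCast_eq_zero_iff 1 L).not.mpr (fun h => by have := Nat.le_of_dvd one_pos h; omega)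
    simpa using this
  have h2 : (1 : ZMod L) ≠ -1 := by
    intro h
    have h3 : ((2 : ℕ) : ZMod L) = 0 := by
      push_cast
      linear_combination h
    have := Nat.le_of_dvd two_pos ((ZMod.natCast_eq_zero_iff 2 L).mp h3)
    omega
  rintro ⟨ν, s⟩ ⟨ν', s'⟩ h
  have hν : ν = ν' := by
    by_contra hne
    have := congrFun h ν
    cases s <;> simp [unitStep, hne, h1] at this
  subst hν
  have := congrFun h ν
  cases s <;> cases s' <;> simp [unitStep, h2, h2.symm] at this ⊢

lemma sum_isNN [NeZero L] (hL : 3 ≤ L) {M : Type*} [AddCommMonoid M] (x : Lam d L)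
    (f : Lam d L → M) :
    (∑ y, if isNN x y then f y else 0) = ∑ p : Fin d × Bool, f (x + unitStep p) := by
  rw [← Finset.sum_filter]
  symm
  refine Finset.sum_nbij (fun p => x + unitStep p) (fun p _ => ?_)
    (fun p _ q _ h => unitStep_injective hL (add_left_cancel h)) (fun y hy => ?_)
    (fun _ _ => rfl)
  · simpa using isNN_iff_exists_unitStep.mpr ⟨p, rfl⟩
  · obtain ⟨p, hp⟩ := isNN_iff_exists_unitStep.mp (by simpa using hy)
    exact ⟨p, by simp, hp⟩

lemma sum_isNN_one [NeZero L] (hL : 3 ≤ L) (x : Lam d L) :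
    (∑ y, if isNN x y then (1 : ℝ) else 0) = 2 * d := by
  rw [sum_isNN hL]
  simp [mul_comm]

/-- The normalized plane wave with momentum `2πk/L`. -/
def planeWave [NeZero L] (k : Lam d L) : EuclideanSpace ℂ (Lam d L) :=
  WithLp.toLp 2 fun x =>
    ((Real.sqrt (Fintype.card (Lam d L)))⁻¹ : ℂ) * ZMod.stdAddChar (k ⬝ᵥ x)

lemma planeWave_apply [NeZero L] (k x : Lam d L) :
    planeWave k x = ((Real.sqrt (Fintype.card (Lam d L)))⁻¹ : ℂ) * ZMod.stdAddChar (k ⬝ᵥ x) :=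
  rfl

lemma sum_stdAddChar_dotProduct [NeZero L] (k : Lam d L) :
    ∑ x : Lam d L, (ZMod.stdAddChar (k ⬝ᵥ x) : ℂ) =
      if k = 0 then (Fintype.card (Lam d L) : ℂ) else 0 := by
  split_ifs with hk
  · subst hk
    simp
  · let ψ : AddChar (Lam d L) ℂ := ZMod.stdAddChar.compAddMonoidHom
      (AddMonoidHom.mk' (fun x => k ⬝ᵥ x) (dotProduct_add k))
    refine AddChar.sum_eq_zero_of_ne_one (ψ := ψ) fun h => ?_
    obtain ⟨i, hi⟩ := Function.ne_iff.mp hk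
    refine ZMod.isPrimitive_stdAddChar L hi ?_
    ext t
    have := DFunLike.congr_fun h (Pi.single i t)
    simpa [ψ, AddChar.mulShift_apply] using this

lemma planeWave_orthonormal [NeZero L] : Orthonormal ℂ (planeWave : Lam d L → _) := by
  rw [orthonormal_iff_ite]
  intro k k'
  have hN : (0 : ℝ) < Fintype.card (Lam d L) := by exact_mod_cast Fintype.card_pos
  have hs : ((Real.sqrt (Fintype.card (Lam d L)))⁻¹ : ℂ) *
      ((Real.sqrt (Fintype.card (Lam d L)))⁻¹ : ℂ) = ((Fintype.card (Lam d L) : ℂ))⁻¹ := by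
    rw [← mul_inv, ← Complex.ofReal_mul, Real.mul_self_sqrt hN.le, Complex.ofReal_natCast]
  have h : ∀ x : Lam d L, inner ℂ (planeWave k x) (planeWave k' x) =
      ((Fintype.card (Lam d L) : ℂ))⁻¹ * ZMod.stdAddChar ((k' - k) ⬝ᵥ x) := by
    intro x
    rw [RCLike.inner_apply, planeWave_apply, planeWave_apply, map_mul,
      ← AddChar.map_neg_eq_conj, map_inv₀, Complex.conj_ofReal, mul_mul_mul_comm, hs,
      ← AddChar.map_add_eq_mul, sub_dotProduct, sub_eq_add_neg]
  rw [PiLp.inner_apply, Finset.sum_congr rfl fun x _ => h x, ← Finset.mul_sum,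
    sum_stdAddChar_dotProduct]
  by_cases hk : k = k'
  · rw [if_pos (sub_eq_zero.mpr hk.symm), if_pos hk]
    exact inv_mul_cancel₀ (by exact_mod_cast hN.ne')
  · rw [if_neg (sub_ne_zero.mpr (Ne.symm hk)), if_neg hk, mul_zero]

/-- The orthonormal basis of plane waves. -/
def planeWaveBasis (d L : ℕ) [NeZero L] :
    OrthonormalBasis (Lam d L) ℂ (EuclideanSpace ℂ (Lam d L)) :=
  (basisOfOrthonormalOfCardEqFinrank planeWave_orthonormal
    (by rw [finrank_euclideanSpace])).toOrthonormalBasis (by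
      rw [coe_basisOfOrthonormalOfCardEqFinrank]
      exact planeWave_orthonormal)

lemma planeWaveBasis_apply [NeZero L] (k : Lam d L) : planeWaveBasis d L k = planeWave k := by
  simp [planeWaveBasis]

/-- The dispersion relation `∑ᵢ 2 (1 - cos (2πkᵢ/L))`. -/
def dispersion [NeZero L] (k : Lam d L) : ℝ :=
  ∑ i, 2 * (1 - (ZMod.stdAddChar (k i) : ℂ).re)

lemma dispersion_nonneg [NeZero L] (k : Lam d L) : 0 ≤ dispersion k := by
  refine Finset.sum_nonneg fun i _ => ?_
  have := Complex.re_le_norm (ZMod.stdAddChar (k i) : ℂ)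
  rw [AddChar.norm_apply] at this
  linarith

lemma planeWave_add_unitStep [NeZero L] (k x : Lam d L) (p : Fin d × Bool) :
    planeWave k (x + unitStep p) =
      planeWave k x * ZMod.stdAddChar (if p.2 then k p.1 else -k p.1) := by
  rw [planeWave_apply, planeWave_apply, dotProduct_add, AddChar.map_add_eq_mul, ← mul_assoc]
  congr 2
  rw [unitStep, dotProduct_single]
  split_ifs <;> simp

lemma sum_isNN_planeWave [NeZero L] (hL : 3 ≤ L) (k x : Lam d L) :
    (∑ y, if isNN x y then planeWave k y else 0) =
      ((2 * d - dispersion k : ℝ) : ℂ) * planeWave k x := by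
  have h : ∀ i, (ZMod.stdAddChar (k i) : ℂ) + ZMod.stdAddChar (-k i) =
      ((2 - 2 * (1 - (ZMod.stdAddChar (k i) : ℂ).re) : ℝ) : ℂ) := by
    intro i
    rw [AddChar.map_neg_eq_conj, Complex.add_conj]
    push_cast
    ring
  rw [sum_isNN hL, Fintype.sum_prod_type]
  simp only [planeWave_add_unitStep, Fintype.sum_bool, if_true, Bool.false_eq_true, if_false,
    ← mul_add, h]
  rw [← Finset.mul_sum, mul_comm, ← Complex.ofReal_sum, Finset.sum_sub_distrib, dispersion]
  simp [mul_comm]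

lemma hopMatrix_isNN_planeWave [NeZero L] (hL : 3 ≤ L) (μ : ℝ) (k : Lam d L) :
    toEuclideanLin (hopMatrix isNN (2 * d - μ)) (planeWave k) =
      ((dispersion k - μ : ℝ) : ℂ) • planeWave k := by
  ext x
  rw [toEuclideanLin_hopMatrix_apply, sum_isNN_planeWave hL, PiLp.smul_apply, smul_eq_mul]
  push_cast
  ring

lemma neg_lap_sub_eq_hopMatrix (μ : ℝ) :
    -(lap d L) - (μ : ℂ) • 1 = hopMatrix isNN (2 * d - μ) := by
  simp only [lap, hopMatrix]
  push_cast
  module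

end Torus

section DomainWall

variable {d L : ℕ} [NeZero L]

lemma neg_pinched_lap_sub_eq_hopMatrix (Ω : Set (Lam d L)) (μ : ℝ) :
    -(proj Ω * lap d L * proj Ω + proj Ωᶜ * lap d L * proj Ωᶜ) - (μ : ℂ) • 1 =
      hopMatrix (sameSideRel isNN Ω) (2 * d - μ) := by
  ext x y
  by_cases hxy : x = y
  · subst hxy
    by_cases hx : x ∈ Ω <;> by_cases hn : isNN x x <;>
      simp [proj, lap, hopMatrix, sameSideRel, hx, hn] <;> ring
  · by_cases hx : x ∈ Ω <;> by_cases hy : y ∈ Ω <;> by_cases hn : isNN x y <;>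
      simp [proj, lap, hopMatrix, sameSideRel, hx, hy, hn, hxy]

omit [NeZero L] in
lemma sameSideRel_isNN_symm (Ω : Set (Lam d L)) (x y : Lam d L)
    (h : sameSideRel isNN Ω x y) : sameSideRel isNN Ω y x :=
  ⟨isNN_symm h.1, h.2.symm⟩

lemma sum_sameSideRel_add_sum_crossRel (hL : 3 ≤ L) (Ω : Set (Lam d L)) (x : Lam d L) :
    (∑ y, if sameSideRel isNN Ω x y then (1 : ℝ) else 0) +
      (∑ y, if crossRel isNN Ω x y then (1 : ℝ) else 0) = 2 * d := by
  rw [← sum_isNN_one hL x, ← Finset.sum_add_distrib]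
  refine Finset.sum_congr rfl fun y _ => ?_
  by_cases h1 : isNN x y <;> by_cases h2 : (x ∈ Ω ↔ y ∈ Ω) <;>
    simp [sameSideRel, crossRel, h1, h2]

lemma sum_sameSideRel_le (hL : 3 ≤ L) (Ω : Set (Lam d L)) (x : Lam d L) :
    (∑ y, if sameSideRel isNN Ω x y then (1 : ℝ) else 0) ≤ 2 * d := by
  have h : 0 ≤ ∑ y, if crossRel isNN Ω x y then (1 : ℝ) else 0 := by positivity
  linarith [sum_sameSideRel_add_sum_crossRel hL Ω x]

lemma sum_sameSideRel_le_of_crossRel (hL : 3 ≤ L) (Ω : Set (Lam d L)) {x y : Lam d L}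
    (hxy : crossRel isNN Ω x y) :
    (∑ y, if sameSideRel isNN Ω x y then (1 : ℝ) else 0) ≤ 2 * d - 1 := by
  have h : 1 ≤ ∑ y, if crossRel isNN Ω x y then (1 : ℝ) else 0 := by
    refine le_trans ?_ (Finset.single_le_sum (fun z _ => ?_) (Finset.mem_univ y))
    · rw [if_pos hxy]
    · positivity
  linarith [sum_sameSideRel_add_sum_crossRel hL Ω x]

lemma re_inner_pinched_le (hL : 3 ≤ L) (Ω : Set (Lam d L)) (μ : ℝ)
    (v : EuclideanSpace ℂ (Lam d L)) :
    (inner ℂ v (toEuclideanLin (hopMatrix (sameSideRel isNN Ω) (2 * d - μ)) v)).re ≤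
      (4 * d - μ) * ‖v‖ ^ 2 := by
  have h := (abs_le.mp (abs_sum_hopping_le (sameSideRel_isNN_symm Ω) v (2 * d)
    fun x _ => sum_sameSideRel_le hL Ω x)).1
  rw [re_inner_hopMatrix]
  linarith

/-- Vectors supported on the two sides of the domain wall have energy at least `1 - μ`. -/
lemma le_re_inner_pinched (hL : 3 ≤ L) (Ω : Set (Lam d L)) (μ : ℝ)
    (v : EuclideanSpace ℂ (Lam d L)) (hv : ∀ x, v x ≠ 0 → ∃ y, crossRel isNN Ω x y) :
    (1 - μ) * ‖v‖ ^ 2 ≤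
      (inner ℂ v (toEuclideanLin (hopMatrix (sameSideRel isNN Ω) (2 * d - μ)) v)).re := by
  have h := (abs_le.mp (abs_sum_hopping_le (sameSideRel_isNN_symm Ω) v (2 * d - 1)
    fun x hx => (hv x hx).elim fun y hy => sum_sameSideRel_le_of_crossRel hL Ω hy)).2
  rw [re_inner_hopMatrix]
  linarith

lemma norm_sq_sum_crossRel_planeWave_ge (hL : 3 ≤ L) (Ω : Set (Lam d L)) (k : Lam d L)
    (hk : ∀ i, 3 / 4 ≤ (ZMod.stdAddChar (k i) : ℂ).re) {x y : Lam d L}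
    (hxy : crossRel isNN Ω x y) :
    9 / 16 / (Fintype.card (Lam d L) : ℝ) ≤
      ‖∑ y, if crossRel isNN Ω x y then planeWave k y else 0‖ ^ 2 := by
  have h1 : (∑ y, if crossRel isNN Ω x y then planeWave k y else 0) =
      planeWave k x * ∑ p : Fin d × Bool, if crossRel isNN Ω x (x + unitStep p) then
        (ZMod.stdAddChar (if p.2 then k p.1 else -k p.1) : ℂ) else 0 := by
    calc (∑ y, if crossRel isNN Ω x y then planeWave k y else 0)
        = ∑ y, if isNN x y then (if crossRel isNN Ω x y then planeWave k y else 0) else 0 := by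
          refine Finset.sum_congr rfl fun y _ => ?_
          by_cases h : isNN x y <;> simp [crossRel, h]
      _ = _ := by
          rw [sum_isNN hL, Finset.mul_sum]
          refine Finset.sum_congr rfl fun p _ => ?_
          rw [planeWave_add_unitStep]
          split_ifs <;> simp
  obtain ⟨q, hq⟩ := isNN_iff_exists_unitStep.mp hxy.1
  have h2 : ∀ p : Fin d × Bool,
      3 / 4 ≤ (ZMod.stdAddChar (if p.2 then k p.1 else -k p.1) : ℂ).re := by
    intro p
    split_ifs
    · exact hk p.1
    · rw [AddChar.map_neg_eq_conj, Complex.conj_re]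
      exact hk p.1
  have h3 : 3 / 4 ≤ ‖∑ p : Fin d × Bool, if crossRel isNN Ω x (x + unitStep p) then
        (ZMod.stdAddChar (if p.2 then k p.1 else -k p.1) : ℂ) else 0‖ := by
    refine le_trans ?_ (Complex.re_le_norm _)
    rw [Complex.re_sum]
    refine le_trans ?_ (Finset.single_le_sum (fun p _ => ?_) (Finset.mem_univ q))
    · rw [hq, if_pos hxy]
      exact h2 q
    · by_cases hp : crossRel isNN Ω x (x + unitStep p)
      · rw [if_pos hp]
        linarith [h2 p]
      · rw [if_neg hp, Complex.zero_re]
  have hpw : ‖planeWave k x‖ ^ 2 = (Fintype.card (Lam d L) : ℝ)⁻¹ := by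
    rw [planeWave_apply, norm_mul, AddChar.norm_apply, mul_one, norm_inv, Complex.norm_real,
      Real.norm_of_nonneg (Real.sqrt_nonneg _), inv_pow, Real.sq_sqrt (Nat.cast_nonneg _)]
  rw [h1, norm_mul, mul_pow, hpw, div_eq_inv_mul]
  gcongr
  nlinarith

/-- A plane wave of small momentum, or its sign flip, is mapped by the pinched operator to a
multiple of itself plus a large vector supported on the domain wall. -/
lemma half_wall_mass_le (hL : 3 ≤ L) (Ω : Set (Lam d L)) (μ : ℝ) (hμ : μ ≤ 1 / 2)
    {ι : Type*} [Fintype ι] (w : OrthonormalBasis ι ℂ (EuclideanSpace ℂ (Lam d L)))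
    (l : ι → ℝ) (hw : ∀ j, toEuclideanLin (hopMatrix (sameSideRel isNN Ω) (2 * d - μ)) (w j) =
      (l j : ℂ) • w j) (k : Lam d L) (hkμ : dispersion k ≤ μ)
    (hk : ∀ i, 3 / 4 ≤ (ZMod.stdAddChar (k i) : ℂ).re) :
    9 / 32 / (Fintype.card (Lam d L) : ℝ) * (bdry Ω).ncard ≤
      (4 * d) ^ 3 * ((∑ j with 0 ≤ l j, ‖inner ℂ (w j) (planeWave k)‖ ^ 2 +
        ∑ j with 0 ≤ l j, ‖inner ℂ (w j) (signFlip Ω (planeWave k))‖ ^ 2) / 2) := by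
  set Y := toEuclideanLin (hopMatrix (sameSideRel isNN Ω) (2 * d - μ)) with hY
  set a : ℝ := dispersion k - μ with ha
  set b : EuclideanSpace ℂ (Lam d L) := Y (planeWave k) - (a : ℂ) • planeWave k with hb
  have hbx : ∀ x, b x = ∑ y, if crossRel isNN Ω x y then planeWave k y else 0 := by
    intro x
    rw [← hopMatrix_pinching_sub, hopMatrix_isNN_planeWave hL]
    rfl
  have hsupp : ∀ x, b x ≠ 0 → ∃ y, crossRel isNN Ω x y := by
    intro x hx
    by_contra! hne
    exact hx (by rw [hbx]; simp [hne])
  have hl : ∀ j, l j - a ≤ 4 * d := by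
    intro j
    have h := re_inner_pinched_le hL Ω μ (w j)
    rw [hw, inner_smul_right, inner_self_eq_norm_sq_to_K, w.norm_eq_one] at h
    simp only [Complex.coe_algebraMap, Complex.ofReal_one, one_pow, mul_one,
      Complex.ofReal_re] at h
    linarith [dispersion_nonneg k]
  have hbU : signFlip Ω b = Y (signFlip Ω (planeWave k)) -
      (a : ℂ) • signFlip Ω (planeWave k) := by
    rw [hY, hopMatrix_pinching_signFlip, ← hY]
    ext x
    simp only [hb, signFlip_apply, PiLp.sub_apply, PiLp.smul_apply, smul_eq_mul]
    split_ifs <;> ring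
  have hen : ∀ v : EuclideanSpace ℂ (Lam d L), (∀ x, v x ≠ 0 → ∃ y, crossRel isNN Ω x y) →
      ‖v‖ ^ 2 / 2 ≤ (inner ℂ v (Y v)).re := by
    intro v hv
    refine le_trans ?_ (le_re_inner_pinched hL Ω μ v hv)
    nlinarith [sq_nonneg ‖v‖]
  have h1 := half_norm_sq_le_mass_nonneg w Y l hw a (4 * d) (by linarith) hl _ b hb
    (hen b hsupp)
  have h2 := half_norm_sq_le_mass_nonneg w Y l hw a (4 * d) (by linarith) hl _ _ hbU
    (hen _ fun x hx => hsupp x fun h0 => hx (by simp [signFlip_apply, h0]))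
  rw [norm_signFlip] at h2
  have h3 : 9 / 16 / (Fintype.card (Lam d L) : ℝ) * (bdry Ω).ncard ≤ ‖b‖ ^ 2 := by
    have hcard : ((bdry Ω).ncard : ℝ) = ∑ x : Lam d L, if x ∈ bdry Ω then (1 : ℝ) else 0 := by
      rw [Finset.sum_boole, Set.ncard_eq_toFinset_card', Set.toFinset_card,
        Fintype.card_subtype]
    rw [EuclideanSpace.norm_sq_eq, hcard, Finset.mul_sum]
    refine Finset.sum_le_sum fun x _ => ?_
    split_ifs with hx
    · obtain ⟨hxΩ, y, hy, hxy⟩ := hx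
      rw [mul_one, hbx]
      exact norm_sq_sum_crossRel_planeWave_ge hL Ω k hk ⟨hxy, by simp [hxΩ, hy]⟩
    · simp
  calc 9 / 32 / (Fintype.card (Lam d L) : ℝ) * (bdry Ω).ncard
      = 9 / 16 / (Fintype.card (Lam d L) : ℝ) * (bdry Ω).ncard / 2 := by ring
    _ ≤ _ := by linarith

/-- Every momentum with energy at most `μ - η` contributes to the cost of the domain wall. -/
lemma card_mul_le_negTrace_sub (hL : 3 ≤ L) (hd : 1 ≤ d) (Ω : Set (Lam d L)) (μ η : ℝ)
    (hμ : μ ≤ 1 / 2) (hη : 0 ≤ η) (S : Finset (Lam d L))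
    (hS : ∀ k ∈ S, dispersion k ≤ μ - η)
    (hS' : ∀ k ∈ S, ∀ i, 3 / 4 ≤ (ZMod.stdAddChar (k i) : ℂ).re) :
    S.card * (η * (9 / 32 / (Fintype.card (Lam d L) : ℝ) * (bdry Ω).ncard / (4 * d) ^ 3)) ≤
      negTrace (hopMatrix (sameSideRel isNN Ω) (2 * d - μ)) -
        negTrace (hopMatrix (isNN : Lam d L → Lam d L → Prop) (2 * d - μ)) := by
  have hY := hopMatrix_isHermitian (sameSideRel_isNN_symm Ω) (2 * d - μ)
  have hX := hopMatrix_isHermitian (c := (isNN : Lam d L → Lam d L → Prop))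
    (fun _ _ => isNN_symm) (2 * d - μ)
  rw [negTrace, negTrace, dif_pos hY, dif_pos hX]
  have he : ∀ k, toEuclideanLin (hopMatrix isNN (2 * d - μ)) (planeWaveBasis d L k) =
      ((dispersion k - μ : ℝ) : ℂ) • planeWaveBasis d L k := by
    intro k
    rw [planeWaveBasis_apply, hopMatrix_isNN_planeWave hL]
  have h1 := sum_min_le_sum_min hX.eigenvectorBasis (planeWaveBasis d L) _ _ _
    (toEuclideanLin_eigenvectorBasis hX) he
  have h2 := sum_min_pinching_sub_ge hY.eigenvectorBasis (planeWaveBasis d L) _ _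
    (signFlip Ω) _ _ (toEuclideanLin_eigenvectorBasis hY) he (norm_signFlip Ω)
    (inner_signFlip Ω) (re_inner_hopMatrix_pinching isNN Ω _)
  refine le_trans (le_trans ?_ h2) (sub_le_sub_left h1 _)
  have hd0 : (0 : ℝ) < 4 * d := by positivity
  rw [← nsmul_eq_mul, ← Finset.sum_const]
  refine le_trans (Finset.sum_le_sum fun k hk => ?_)
    (Finset.sum_le_sum_of_subset_of_nonneg (Finset.subset_univ S) fun k _ _ =>
      mul_nonneg (neg_nonneg.mpr (min_le_right _ _)) (by positivity))
  rw [planeWaveBasis_apply]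
  have hη' : η ≤ -min (dispersion k - μ) 0 := by
    have := min_le_left (dispersion k - μ) 0
    linarith [hS k hk]
  have hm := half_wall_mass_le hL Ω μ hμ hY.eigenvectorBasis _
    (toEuclideanLin_eigenvectorBasis hY) k (by linarith [hS k hk]) (hS' k hk)
  refine mul_le_mul hη' ?_ (by positivity) (hη.trans hη')
  rw [div_le_iff₀' (by positivity)]
  exact hm

end DomainWall

section Counting

open MeasureTheory

/-- The points of `ℤ^d` in the box of half-side `M` that `h` scales into the closed ball of
squared radius `R2`. -/
def latticeBall (d : ℕ) (M : ℕ) (h R2 : ℝ) : Finset (Fin d → ℤ) :=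
  {n ∈ Fintype.piFinset fun _ => Finset.Icc (-(M : ℤ)) M | ∑ i, (h * n i) ^ 2 ≤ R2}

lemma sum_sq_mul_of_mem_latticeBall {d M : ℕ} {h R2 : ℝ} {n : Fin d → ℤ}
    (hn : n ∈ latticeBall d M h R2) : ∑ i, (h * n i) ^ 2 ≤ R2 :=
  (Finset.mem_filter.mp hn).2

lemma volume_ball_le_card_latticeBall (d : ℕ) (hd : 1 ≤ d) (M : ℕ) {h ρ R : ℝ} (hh : 0 < h)
    (hρ : 0 ≤ ρ) (hR : ρ + h * √d / 2 ≤ R) (hM : R ≤ h * M) :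
    ρ ^ d * (√Real.pi ^ d / Real.Gamma ((d : ℝ) / 2 + 1)) ≤
      (latticeBall d M h (R ^ 2)).card * h ^ d := by
  have : Nonempty (Fin d) := ⟨⟨0, hd⟩⟩
  have hR0 : 0 ≤ R := le_trans (by positivity) hR
  have hΓ : 0 < Real.Gamma ((d : ℝ) / 2 + 1) := Real.Gamma_pos_of_pos (by positivity)
  have hvol : volume ((WithLp.toLp 2 : (Fin d → ℝ) → EuclideanSpace ℝ (Fin d)) ⁻¹'
      Metric.ball 0 ρ) =
      ENNReal.ofReal (ρ ^ d * (√Real.pi ^ d / Real.Gamma ((d : ℝ) / 2 + 1))) := by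
    rw [(PiLp.volume_preserving_toLp (Fin d)).measure_preimage
      Metric.isOpen_ball.measurableSet.nullMeasurableSet, EuclideanSpace.volume_ball,
      Fintype.card_fin, ENNReal.ofReal_mul (by positivity), ENNReal.ofReal_pow hρ]
  have hcover : (WithLp.toLp 2 : (Fin d → ℝ) → EuclideanSpace ℝ (Fin d)) ⁻¹'
      Metric.ball 0 ρ ⊆ ⋃ n ∈ latticeBall d M h (R ^ 2),
        Set.Icc (fun i => h * (n i : ℝ) - h / 2) (fun i => h * (n i : ℝ) + h / 2) := by
    intro x hx
    rw [Set.mem_preimage, mem_ball_zero_iff] at hx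
    set n : Fin d → ℤ := fun i => round (x i / h) with hn
    have hclose : ∀ i, |h * (n i : ℝ) - x i| ≤ h / 2 := by
      intro i
      have h1 := abs_sub_round (x i / h)
      calc |h * (n i : ℝ) - x i| = |h * -(x i / h - round (x i / h))| := by
            congr 1
            simp only [hn]
            field_simp
            ring
        _ = h * |x i / h - round (x i / h)| := by
            rw [abs_mul, abs_neg, abs_of_pos hh]
        _ ≤ h * (1 / 2) := by gcongr
        _ = h / 2 := by ring
    have hnorm : ‖(WithLp.toLp 2 fun i => h * (n i : ℝ) : EuclideanSpace ℝ (Fin d))‖ ≤ R := by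
      have hdiff : ‖(WithLp.toLp 2 fun i => h * (n i : ℝ) - x i :
          EuclideanSpace ℝ (Fin d))‖ ≤ h * √d / 2 := by
        rw [EuclideanSpace.norm_eq]
        refine Real.sqrt_le_iff.mpr ⟨by positivity, ?_⟩
        calc ∑ i, ‖h * (n i : ℝ) - x i‖ ^ 2 ≤ ∑ _i : Fin d, (h / 2) ^ 2 := by
              refine Finset.sum_le_sum fun i _ => ?_
              rw [Real.norm_eq_abs]
              gcongr
              exact hclose i
          _ = (h * √d / 2) ^ 2 := by
              rw [Finset.sum_const, Finset.card_univ, Fintype.card_fin, nsmul_eq_mul, div_pow,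
                div_pow, mul_pow, Real.sq_sqrt (Nat.cast_nonneg d)]
              ring
      have heq : (WithLp.toLp 2 fun i => h * (n i : ℝ) : EuclideanSpace ℝ (Fin d)) =
          WithLp.toLp 2 x + WithLp.toLp 2 fun i => h * (n i : ℝ) - x i := by
        ext i
        simp
      rw [heq]
      exact (norm_add_le _ _).trans (by linarith)
    have hsum : ∑ i, (h * (n i : ℝ)) ^ 2 ≤ R ^ 2 := by
      have h2 := pow_le_pow_left₀ (norm_nonneg _) hnorm 2
      rw [EuclideanSpace.norm_sq_eq] at h2
      simpa only [Real.norm_eq_abs, sq_abs] using h2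
    have hbox : ∀ i, n i ∈ Finset.Icc (-(M : ℤ)) M := by
      intro i
      have h3 : (h * (n i : ℝ)) ^ 2 ≤ R ^ 2 :=
        (Finset.single_le_sum (f := fun i => (h * (n i : ℝ)) ^ 2)
          (fun j _ => sq_nonneg _) (Finset.mem_univ i)).trans hsum
      have h4 := abs_le.mp ((abs_le_of_sq_le_sq h3 hR0).trans hM)
      have h5 : (n i : ℝ) ≤ M := le_of_mul_le_mul_left h4.2 hh
      have h6 : -(M : ℝ) ≤ n i := le_of_mul_le_mul_left (by linarith [h4.1]) hh
      exact Finset.mem_Icc.mpr ⟨by exact_mod_cast h6, by exact_mod_cast h5⟩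
    refine Set.mem_biUnion (x := n)
      (Finset.mem_filter.mpr ⟨Fintype.mem_piFinset.mpr hbox, hsum⟩) ?_
    exact ⟨fun i => by linarith [(abs_le.mp (hclose i)).2],
      fun i => by linarith [(abs_le.mp (hclose i)).1]⟩
  have hle := (measure_mono hcover).trans (measure_biUnion_finset_le (μ := volume) _ _)
  have hcube : ∀ n : Fin d → ℤ, volume (Set.Icc (fun i => h * (n i : ℝ) - h / 2)
      (fun i => h * (n i : ℝ) + h / 2)) = ENNReal.ofReal (h ^ d) := by
    intro n
    rw [Real.volume_Icc_pi, ENNReal.ofReal_pow hh.le]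
    simp
  rw [hvol, Finset.sum_congr rfl fun n _ => hcube n, Finset.sum_const, nsmul_eq_mul,
    ← ENNReal.ofReal_natCast, ← ENNReal.ofReal_mul (Nat.cast_nonneg _)] at hle
  exact (ENNReal.ofReal_le_ofReal_iff (by positivity)).mp hle

end Counting

section SmallMomenta

variable {d L : ℕ} [NeZero L]

lemma re_stdAddChar_intCast (n : ℤ) :
    (ZMod.stdAddChar (n : ZMod L) : ℂ).re = Real.cos (2 * Real.pi / L * n) := by
  rw [ZMod.stdAddChar_coe, ← Complex.exp_ofReal_mul_I_re]
  congr 2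
  push_cast
  ring

lemma one_sub_le_re_stdAddChar {M : ℕ} {R2 : ℝ} {n : Fin d → ℤ}
    (hn : n ∈ latticeBall d M (2 * Real.pi / L) R2) (i : Fin d) :
    1 - R2 / 2 ≤ (ZMod.stdAddChar (n i : ZMod L) : ℂ).re := by
  have h1 : (2 * Real.pi / L * n i) ^ 2 ≤ R2 :=
    (Finset.single_le_sum (f := fun i => (2 * Real.pi / L * (n i : ℝ)) ^ 2)
      (fun j _ => sq_nonneg _) (Finset.mem_univ i)).trans (sum_sq_mul_of_mem_latticeBall hn)
  rw [re_stdAddChar_intCast]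
  linarith [Real.one_sub_sq_div_two_le_cos (x := 2 * Real.pi / L * n i)]

lemma dispersion_intCast_le {M : ℕ} {R2 : ℝ} {n : Fin d → ℤ}
    (hn : n ∈ latticeBall d M (2 * Real.pi / L) R2) :
    dispersion (fun i => (n i : ZMod L)) ≤ R2 := by
  refine le_trans (Finset.sum_le_sum fun i _ => ?_) (sum_sq_mul_of_mem_latticeBall hn)
  rw [re_stdAddChar_intCast]
  linarith [Real.one_sub_sq_div_two_le_cos (x := 2 * Real.pi / L * n i)]

omit [NeZero L] in
lemma intCast_injOn_latticeBall {M : ℕ} (hM : 2 * M < L) (h R2 : ℝ) :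
    Set.InjOn (fun (n : Fin d → ℤ) i => (n i : ZMod L)) (latticeBall d M h R2) := by
  intro n hn n' hn' heq
  have hbox : ∀ {m : Fin d → ℤ}, m ∈ latticeBall d M h R2 → ∀ i, -(M : ℤ) ≤ m i ∧ m i ≤ M :=
    fun hm i => Finset.mem_Icc.mp (Fintype.mem_piFinset.mp (Finset.mem_filter.mp hm).1 i)
  funext i
  have h1 := (ZMod.intCast_eq_intCast_iff_dvd_sub _ _ _).mp (congrFun heq i)
  have h2 := hbox hn i
  have h3 := hbox hn' i
  have h4 := Int.eq_zero_of_abs_lt_dvd h1 (abs_lt.mpr ⟨by omega, by omega⟩)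
  omega

end SmallMomenta

lemma alphaStar_eq (d : ℕ) {μ : ℝ} (hμ : 0 < μ) :
    alphaStar d μ = √Real.pi ^ d * √(μ / 2) ^ d / Real.Gamma ((d : ℝ) / 2) /
      (2 * Real.pi) ^ d * μ / (4 * d) ^ 5 := by
  have h1 : Real.pi ^ ((d : ℝ) / 2) = √Real.pi ^ d := by
    rw [Real.sqrt_eq_rpow, ← Real.rpow_mul_natCast Real.pi_pos.le]
    congr 1
    ring
  have h2 : μ ^ ((2 + (d : ℝ)) / 2) / 2 ^ (1 + (d : ℝ) / 2) = μ / 2 * √(μ / 2) ^ d := by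
    rw [show (2 + (d : ℝ)) / 2 = 1 + (d : ℝ) / 2 by ring,
      ← Real.div_rpow hμ.le two_pos.le, Real.rpow_add (by positivity), Real.rpow_one,
      Real.sqrt_eq_rpow, ← Real.rpow_mul_natCast (by positivity)]
    congr 2
    ring
  rw [alphaStar, sphereMeasure, h1, mul_assoc ((2 : ℝ) ^ _), mul_div_assoc, ← div_div, h2]
  ring

/-- Lemma 3.6 (ii), Freericks–Lieb–Ueltschi: for `0 < μ ≤ 1/2` and
`L ≥ 4πd/μ`, decoupling the Laplacian across `∂Ω` costs at least `α(μ)|∂Ω|`: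
`Tr{[-Δ̃-μ]_-} - Tr{[-Δ-μ]_-} ≥ α(μ)|∂Ω|` with `Δ̃ = P_ΩΔP_Ω + P_Ω^⊥ΔP_Ω^⊥`. -/
theorem domain_wall_energy_small_mu (d L : ℕ) (hd : 1 ≤ d) [NeZero L]
    (hLeven : Even L) (μ : ℝ) (hμ0 : 0 < μ) (hμh : μ ≤ 1 / 2)
    (hL : 4 * Real.pi * d / μ ≤ (L : ℝ)) (Ω : Set (Lam d L)) :
    alphaStar d μ * (bdry Ω).ncard ≤
      negTrace (-(proj Ω * lap d L * proj Ω + proj Ωᶜ * lap d L * proj Ωᶜ)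
          - (μ : ℂ) • 1)
        - negTrace (-(lap d L) - (μ : ℂ) • 1) := by
  have hd' : (1 : ℝ) ≤ d := by exact_mod_cast hd
  have hπ := Real.pi_gt_three
  have hL25 : 25 < (L : ℝ) := by
    have h1 : 8 * Real.pi ≤ 4 * Real.pi * d / μ := by
      rw [le_div_iff₀ hμ0]
      nlinarith
    linarith [Real.pi_gt_d2]
  have hL0 : (0 : ℝ) < L := by linarith
  have hL3 : 3 ≤ L := by
    have : (3 : ℝ) ≤ L := by linarith
    exact_mod_cast this
  rw [neg_pinched_lap_sub_eq_hopMatrix, neg_lap_sub_eq_hopMatrix]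
  set h : ℝ := 2 * Real.pi / L with hh
  have hh0 : 0 < h := by positivity
  have hhμ : h ≤ μ / (2 * d) := by
    rw [hh, div_le_div_iff₀ hL0 (by positivity)]
    rw [div_le_iff₀ hμ0] at hL
    linarith
  set s := √(μ / 2) with hs
  have hs0 : 0 ≤ s := Real.sqrt_nonneg _
  have hs2 : s ^ 2 = μ / 2 := Real.sq_sqrt (by positivity)
  have hs1 : s ≤ 1 / 2 := Real.sqrt_le_iff.mpr ⟨by norm_num, by linarith⟩
  have hR : s + h * √d / 2 ≤ 5 / 4 * s := by
    have h1 : √(d : ℝ) ≤ d := Real.sqrt_le_iff.mpr ⟨by positivity, by nlinarith⟩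
    have h2 : h * √d ≤ μ / 2 := by
      calc h * √d ≤ μ / (2 * d) * d := by gcongr
        _ = μ / 2 := by field_simp
    nlinarith
  have hM : 5 / 4 * s ≤ h * ((L - 1) / 2 : ℕ) := by
    have h1 : (L : ℝ) / 2 - 1 ≤ ((L - 1) / 2 : ℕ) := by
      have h2 : L ≤ 2 * ((L - 1) / 2) + 2 := by omega
      have h3 : (L : ℝ) ≤ 2 * ((L - 1) / 2 : ℕ) + 2 := by exact_mod_cast h2
      linarith
    calc 5 / 4 * s ≤ 5 / 8 := by linarith
      _ ≤ h * (L / 2 - 1) := by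
          rw [hh, div_mul_eq_mul_div, le_div_iff₀ hL0]
          nlinarith
      _ ≤ _ := by gcongr
  have hvol := volume_ball_le_card_latticeBall d hd _ hh0 hs0 hR hM
  set B := latticeBall d ((L - 1) / 2) h ((5 / 4 * s) ^ 2) with hB
  have hR2 : (5 / 4 * s) ^ 2 ≤ μ - μ / 5 := by
    rw [mul_pow, hs2]
    linarith
  have hkey := card_mul_le_negTrace_sub hL3 hd Ω μ (μ / 5) hμh (by positivity)
    (B.image fun n i => (n i : ZMod L))
    (fun k hk => by
      obtain ⟨n, hn, rfl⟩ := Finset.mem_image.mp hk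
      exact (dispersion_intCast_le hn).trans hR2)
    (fun k hk i => by
      obtain ⟨n, hn, rfl⟩ := Finset.mem_image.mp hk
      exact le_trans (by linarith) (one_sub_le_re_stdAddChar hn i))
  rw [Finset.card_image_of_injOn (intCast_injOn_latticeBall (by omega) _ _)] at hkey
  refine le_trans ?_ hkey
  have hcard : (Fintype.card (Lam d L) : ℝ) = L ^ d := by
    simp [ZMod.card]
  have hΓ : 0 < Real.Gamma ((d : ℝ) / 2) := Real.Gamma_pos_of_pos (by positivity)
  rw [Real.Gamma_add_one (by positivity)] at hvol
  have hdens : s ^ d * (√Real.pi ^ d / (d / 2 * Real.Gamma ((d : ℝ) / 2))) /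
      (2 * Real.pi) ^ d ≤ B.card / (L : ℝ) ^ d := by
    rw [div_le_iff₀ (by positivity)]
    refine hvol.trans_eq ?_
    rw [hh, div_pow]
    ring
  set G := √Real.pi ^ d * s ^ d / Real.Gamma ((d : ℝ) / 2) / (2 * Real.pi) ^ d with hG
  have hG0 : 0 ≤ G := by positivity
  have hGB : G * (2 / d) ≤ B.card / (L : ℝ) ^ d := by
    refine le_of_eq_of_le ?_ hdens
    rw [hG]
    field_simp
  rw [alphaStar_eq d hμ0, ← hs, ← hG, hcard]
  calc G * μ / (4 * d) ^ 5 * (bdry Ω).ncard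
      ≤ G * (2 / d) * (μ / 5 * (9 / 32 * (bdry Ω).ncard / (4 * d) ^ 3)) := by
        have h1 : 1 / (4 * (d : ℝ)) ^ 2 ≤ 9 / (80 * d) := by
          rw [div_le_div_iff₀ (by positivity) (by positivity)]
          nlinarith
        calc G * μ / (4 * d) ^ 5 * (bdry Ω).ncard
            = G * μ * (bdry Ω).ncard / (4 * d) ^ 3 * (1 / (4 * (d : ℝ)) ^ 2) := by
              field_simp
          _ ≤ G * μ * (bdry Ω).ncard / (4 * d) ^ 3 * (9 / (80 * d)) := by gcongr
          _ = _ := by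
              field_simp
              ring
    _ ≤ B.card / (L : ℝ) ^ d * (μ / 5 * (9 / 32 * (bdry Ω).ncard / (4 * d) ^ 3)) := by
        gcongr
    _ = _ := by ring
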